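/- Let q be a prime power, K a finite field with q elements, K̄ an algebraic closure of K, and φ the Frobenius map on P¹(K̄) given by [a : b] ↦ [a^q : b^q]. The number of orbits of the componentwise action of PGL₂(K) on the set of ordered 6-tuples (x₁, …, x₆) of pairwise distinct points of P¹(K̄) satisfying φ(x₁) = x₂, φ(x₂) = x₃, φ(x₃) = x₁ and φ(xᵢ) = xᵢ for i = 4, 5, 6 equals q³ − q. -/

import Mathlib

open Projectivization

/-! ## The projective line and the actions of `GL₂` and `PGL₂` -/

/-- `GL₂(L)` as a group of linear automorphisms of `L²`. -/
noncomputable def glMulEquiv (L : Type*) [Field L] :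
    GL (Fin 2) L ≃* ((Fin 2 → L) ≃ₗ[L] (Fin 2 → L)) :=
  (Matrix.GeneralLinearGroup.toLin).trans
    (LinearMap.GeneralLinearGroup.generalLinearEquiv L (Fin 2 → L))

theorem glMulEquiv_apply (L : Type*) [Field L] (g : GL (Fin 2) L) (v : Fin 2 → L) :
    glMulEquiv L g v = (g : Matrix (Fin 2) (Fin 2) L).mulVec v := by
  simp [glMulEquiv]

/-- The action of `GL₂(L)` on the projective line `P¹(L)`, given in homogeneous
coordinates by `[a : b] ↦ [α a + β b : γ a + δ b]`. -/
noncomputable def glP1 (L : Type*) [Field L] :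
    GL (Fin 2) L →* Function.End (Projectivization L (Fin 2 → L)) where
  toFun g := Projectivization.map (glMulEquiv L g).toLinearMap (glMulEquiv L g).injective
  map_one' := by
    funext x
    induction x using Projectivization.ind with
    | h v hv =>
      show Projectivization.map (glMulEquiv L 1).toLinearMap (glMulEquiv L 1).injective
          (Projectivization.mk L v hv) = Projectivization.mk L v hv
      rw [Projectivization.map_mk, Projectivization.mk_eq_mk_iff']
      exact ⟨1, by simp [glMulEquiv_apply]⟩
  map_mul' g h := by
    funext x
    induction x using Projectivization.ind with
    | h v hv =>
      show Projectivization.map (glMulEquiv L (g * h)).toLinearMap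
          (glMulEquiv L (g * h)).injective (Projectivization.mk L v hv)
        = Projectivization.map (glMulEquiv L g).toLinearMap (glMulEquiv L g).injective
            (Projectivization.map (glMulEquiv L h).toLinearMap (glMulEquiv L h).injective
              (Projectivization.mk L v hv))
      rw [Projectivization.map_mk, Projectivization.map_mk, Projectivization.map_mk,
        Projectivization.mk_eq_mk_iff']
      exact ⟨1, by simp [glMulEquiv_apply, Matrix.mulVec_mulVec]⟩

/-- The action of `GL₂(L)` on `P¹(L)` as a `MulAction`. -/
noncomputable instance glP1Action (L : Type*) [Field L] :
    MulAction (GL (Fin 2) L) (Projectivization L (Fin 2 → L)) :=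
  MulAction.ofEndHom (glP1 L)

/-- The subgroup of scalar matrices inside `GL₂(L)`. -/
def scalarSubgroup (L : Type*) [Field L] : Subgroup (GL (Fin 2) L) :=
  (Units.map ((Matrix.scalar (Fin 2)) : L →+* Matrix (Fin 2) (Fin 2) L).toMonoidHom).range

instance scalarSubgroup_normal (L : Type*) [Field L] : (scalarSubgroup L).Normal := by
  constructor
  rintro n ⟨a, rfl⟩ g
  refine ⟨a, ?_⟩
  have hc : Commute (Units.map ((Matrix.scalar (Fin 2)) :
      L →+* Matrix (Fin 2) (Fin 2) L).toMonoidHom a) g := by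
    apply Units.ext
    simpa using (Matrix.scalar_commute (a : L) (fun r => mul_comm _ _)
      (g : Matrix (Fin 2) (Fin 2) L)).eq
  rw [← hc.eq, mul_assoc, mul_inv_cancel, mul_one]

/-- `PGL₂(K)`: the quotient of `GL₂(K)` by the subgroup of scalar matrices. -/
abbrev PGL2 (K : Type*) [Field K] := GL (Fin 2) K ⧸ scalarSubgroup K

/-- Scalar matrices act trivially on the projective line. -/
theorem glP1_scalar_eq_one (L : Type*) [Field L] (a : Lˣ) :
    glP1 L (Units.map ((Matrix.scalar (Fin 2)) :
      L →+* Matrix (Fin 2) (Fin 2) L).toMonoidHom a) = 1 := by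
  set u := Units.map ((Matrix.scalar (Fin 2)) :
      L →+* Matrix (Fin 2) (Fin 2) L).toMonoidHom a with hu
  funext x
  induction x using Projectivization.ind with
  | h v hv =>
    show Projectivization.map (glMulEquiv L u).toLinearMap (glMulEquiv L u).injective
        (Projectivization.mk L v hv) = Projectivization.mk L v hv
    rw [Projectivization.map_mk, Projectivization.mk_eq_mk_iff']
    refine ⟨(a : L), ?_⟩
    simp [glMulEquiv_apply, hu, Matrix.scalar_apply, Matrix.diagonal_const_mulVec]

/-- For a field homomorphism `f : K →+* L`, the scalar matrices of `GL₂(K)` act trivially on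
`P¹(L)`, hence the action of `GL₂(K)` on `P¹(L)` descends to an action of `PGL₂(K)`. -/
noncomputable def pglP1 {K L : Type*} [Field K] [Field L] (f : K →+* L) :
    PGL2 K →* Function.End (Projectivization L (Fin 2 → L)) :=
  QuotientGroup.lift (scalarSubgroup K)
    ((glP1 L).comp (Matrix.GeneralLinearGroup.map f))
    (by
      rintro z ⟨a, rfl⟩
      have key : Matrix.GeneralLinearGroup.map (n := Fin 2) f
          (Units.map ((Matrix.scalar (Fin 2)) : K →+* Matrix (Fin 2) (Fin 2) K).toMonoidHom a)
          = Units.map ((Matrix.scalar (Fin 2)) :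
              L →+* Matrix (Fin 2) (Fin 2) L).toMonoidHom (Units.map f.toMonoidHom a) := by
        apply Units.ext
        ext i j
        simp [Matrix.GeneralLinearGroup.map, Matrix.scalar_apply, Matrix.diagonal,
          Matrix.map_apply, apply_ite f]
      rw [MonoidHom.mem_ker, MonoidHom.comp_apply, key, glP1_scalar_eq_one])

/-- The action of `PGL₂(K)` on `P¹(L)`, for any extension `L` of `K` via `f : K →+* L`. -/
noncomputable def pglP1Action {K L : Type*} [Field K] [Field L] (f : K →+* L) :
    MulAction (PGL2 K) (Projectivization L (Fin 2 → L)) :=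
  MulAction.ofEndHom (pglP1 f)
/-- The Frobenius map on the projective line `P¹(L)`, acting in homogeneous coordinates by
`[a : b] ↦ [a ^ q : b ^ q]`. -/
noncomputable def frobP1 {L : Type*} [Field L] (q : ℕ)
    (x : Projectivization L (Fin 2 → L)) : Projectivization L (Fin 2 → L) :=
  Projectivization.mk L (fun i => (x.rep i) ^ q) (by
    intro hzero
    obtain ⟨i, hi⟩ := Function.ne_iff.mp x.rep_nonzero
    have h2 : x.rep i ^ q = 0 := congrFun hzero i
    exact hi (by simpa using (pow_eq_zero_iff'.mp h2).1))

noncomputable instance pglP1ClosureAction (K : Type*) [Field K] :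
    MulAction (PGL2 K)
      (Projectivization (AlgebraicClosure K) (Fin 2 → AlgebraicClosure K)) :=
  pglP1Action (algebraMap K (AlgebraicClosure K))

theorem mk_eq_mk_iff_mul_eq_mul {L : Type*} [Field L] {v w : Fin 2 → L} (hv : v ≠ 0)
    (hw : w ≠ 0) : mk L v hv = mk L w hw ↔ v 0 * w 1 = v 1 * w 0 := by
  rw [mk_eq_mk_iff']
  constructor
  · rintro ⟨a, rfl⟩
    simp only [Pi.smul_apply, smul_eq_mul]
    ring
  · intro h
    by_cases h0 : w 0 = 0
    · have h1 : w 1 ≠ 0 := fun h1 => hw (by ext i; fin_cases i <;> simp [h0, h1])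
      have hv0 : v 0 = 0 := by simpa [h0, h1] using h
      refine ⟨v 1 / w 1, ?_⟩
      ext i; fin_cases i <;> simp [h0, h1, hv0]
    · refine ⟨v 0 / w 0, ?_⟩
      ext i
      fin_cases i
      · simp [h0]
      · simp only [Fin.mk_one, Pi.smul_apply, smul_eq_mul]
        field_simp
        linear_combination h

theorem frobP1_mk {L : Type*} [Field L] (q : ℕ) (v : Fin 2 → L) (hv : v ≠ 0)
    (hv' : (fun i => v i ^ q) ≠ 0) : frobP1 q (mk L v hv) = mk L (fun i => v i ^ q) hv' := by
  have h := (mk_eq_mk_iff_mul_eq_mul (rep_nonzero (mk L v hv)) hv).1 (mk_rep _)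
  unfold frobP1
  rw [mk_eq_mk_iff_mul_eq_mul]
  simp only [← mul_pow, h]

theorem mulVec_map_ne_zero {K L : Type*} [Field K] [Field L] (f : K →+* L) (g : GL (Fin 2) K)
    {v : Fin 2 → L} (hv : v ≠ 0) :
    ((g : Matrix (Fin 2) (Fin 2) K).map f).mulVec v ≠ 0 := by
  have h := (glMulEquiv L (Matrix.GeneralLinearGroup.map f g)).injective.ne hv
  rw [map_zero, glMulEquiv_apply] at h
  exact h

section Closure

variable {K : Type*} [Field K]

local notation "Kbar" => AlgebraicClosure K

local notation "ι" => algebraMap K (AlgebraicClosure K)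

theorem pgl_smul_mk (g : GL (Fin 2) K) (v : Fin 2 → Kbar) (hv : v ≠ 0) :
    (QuotientGroup.mk g : PGL2 K) • mk Kbar v hv =
      mk Kbar (((g : Matrix (Fin 2) (Fin 2) K).map ι).mulVec v)
        (mulVec_map_ne_zero ι g hv) := by
  change mk Kbar (glMulEquiv Kbar (Matrix.GeneralLinearGroup.map ι g) v) _ = _
  simp only [glMulEquiv_apply]
  rfl

theorem pow_card_add [Fintype K] (a b : Kbar) :
    (a + b) ^ Fintype.card K = a ^ Fintype.card K + b ^ Fintype.card K := by
  simpa using map_add (FiniteField.frobeniusAlgHom K Kbar) a b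

theorem algebraMap_pow_card [Fintype K] (a : K) : (ι a) ^ Fintype.card K = ι a := by
  rw [← map_pow, FiniteField.pow_card]

theorem frobP1_smul [Fintype K] (g : PGL2 K) (x : Projectivization Kbar (Fin 2 → Kbar)) :
    frobP1 (Fintype.card K) (g • x) = g • frobP1 (Fintype.card K) x := by
  induction g using QuotientGroup.induction_on with | H g => ?_
  induction x using Projectivization.ind with | h v hv => ?_
  have pow_ne {w : Fin 2 → Kbar} (hw : w ≠ 0) : (fun i => w i ^ Fintype.card K) ≠ 0 := by
    obtain ⟨i, hi⟩ := Function.ne_iff.mp hw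
    exact Function.ne_iff.mpr ⟨i, pow_ne_zero _ hi⟩
  rw [pgl_smul_mk, frobP1_mk _ _ _ (pow_ne (mulVec_map_ne_zero ι g hv)),
    frobP1_mk _ _ _ (pow_ne hv), pgl_smul_mk]
  congr 1
  ext i
  simp [Matrix.mulVec, dotProduct, Fin.sum_univ_two, pow_card_add, mul_pow, algebraMap_pow_card]

theorem ncard_pow_card_pow_eq_self [Fintype K] {n : ℕ} (hn : n ≠ 0) :
    {t : Kbar | t ^ Fintype.card K ^ n = t}.ncard = Fintype.card K ^ n := by
  set Q := Fintype.card K ^ n with hQ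
  have hQ1 : 1 < Q := Nat.one_lt_pow hn Fintype.one_lt_card
  have hsep : (Polynomial.X ^ Q - Polynomial.X : Polynomial Kbar).Separable := by
    obtain ⟨p, hp, m, hm, hc⟩ := FiniteField.card' K
    have : CharP Kbar p := charP_of_injective_algebraMap (ι).injective p
    exact galois_poly_separable p Q
      (hQ ▸ hc ▸ dvd_pow (dvd_pow_self p m.ne_zero) hn)
  have h := Polynomial.card_rootSet_eq_natDegree (K := Kbar) hsep (IsAlgClosed.splits _)
  rw [FiniteField.X_pow_card_sub_X_natDegree_eq _ hQ1] at h
  have hset : {t : Kbar | t ^ Q = t} =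
      (Polynomial.X ^ Q - Polynomial.X : Polynomial Kbar).rootSet Kbar := by
    ext t
    rw [Polynomial.mem_rootSet_of_ne (FiniteField.X_pow_card_sub_X_ne_zero _ hQ1)]
    simp [sub_eq_zero]
  rw [hset, ← Nat.card_coe_set_eq, Nat.card_eq_fintype_card, h]

theorem range_algebraMap_eq [Fintype K] :
    Set.range ι = {t : Kbar | t ^ Fintype.card K = t} := by
  have h := ncard_pow_card_pow_eq_self (K := K) one_ne_zero
  rw [pow_one] at h
  refine Set.eq_of_subset_of_ncard_le ?_ ?_ (Set.finite_of_ncard_ne_zero ?_)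
  · rintro _ ⟨a, rfl⟩
    exact algebraMap_pow_card a
  · rw [h, ← Set.image_univ, Set.ncard_image_of_injective _ (ι).injective, Set.ncard_univ,
      Nat.card_eq_fintype_card]
  · rw [h]
    exact Fintype.card_ne_zero

theorem eq_mk_infinity_or_affine {L : Type*} [Field L] (x : Projectivization L (Fin 2 → L)) :
    x = mk L ![1, 0] (by simp) ∨ ∃ t, x = mk L ![t, 1] (by simp) := by
  induction x using Projectivization.ind with | h v hv => ?_
  simp only [mk_eq_mk_iff_mul_eq_mul]
  by_cases h : v 1 = 0
  · simp [h]
  · exact Or.inr ⟨v 0 / v 1, by simp [mul_div_cancel₀ _ h]⟩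

theorem frobP1_affine {L : Type*} [Field L] (q : ℕ) (t : L) :
    frobP1 q (mk L ![t, 1] (by simp)) = mk L ![t ^ q, 1] (by simp) := by
  rw [frobP1_mk _ _ _ (Function.ne_iff.mpr ⟨1, by simp⟩), mk_eq_mk_iff_mul_eq_mul]
  simp

theorem mk_affine_inj {L : Type*} [Field L] {s t : L} :
    mk L ![s, 1] (by simp) = mk L ![t, 1] (by simp) ↔ s = t := by
  simp [mk_eq_mk_iff_mul_eq_mul]

theorem exists_rational_of_frobP1_eq_self [Fintype K] (x : Projectivization Kbar (Fin 2 → Kbar))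
    (hx : frobP1 (Fintype.card K) x = x) :
    ∃ (u : Fin 2 → K) (hu : (fun i => ι (u i)) ≠ 0), x = mk Kbar (fun i => ι (u i)) hu := by
  obtain rfl | ⟨t, rfl⟩ := eq_mk_infinity_or_affine x
  · refine ⟨![1, 0], Function.ne_iff.mpr ⟨0, by simp⟩, ?_⟩
    simp [mk_eq_mk_iff_mul_eq_mul]
  · rw [frobP1_affine, mk_affine_inj] at hx
    obtain ⟨a, rfl⟩ : t ∈ Set.range ι := by rwa [range_algebraMap_eq]
    refine ⟨![a, 1], Function.ne_iff.mpr ⟨1, by simp⟩, ?_⟩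
    simp [mk_eq_mk_iff_mul_eq_mul]

/-- Three distinct rational points are the images of `[1 : 0]`, `[0 : 1]`, `[1 : 1]` under an
element of `PGL₂(K)`. -/
theorem exists_pgl_smul_eq [Fintype K] {x y z : Projectivization Kbar (Fin 2 → Kbar)}
    (hx : frobP1 (Fintype.card K) x = x) (hy : frobP1 (Fintype.card K) y = y)
    (hz : frobP1 (Fintype.card K) z = z) (hxy : x ≠ y) (hxz : x ≠ z) (hyz : y ≠ z) :
    ∃ g : PGL2 K, g • mk Kbar ![1, 0] (by simp) = x ∧ g • mk Kbar ![0, 1] (by simp) = y ∧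
      g • mk Kbar ![1, 1] (by simp) = z := by
  obtain ⟨u, hu, rfl⟩ := exists_rational_of_frobP1_eq_self x hx
  obtain ⟨v, hv, rfl⟩ := exists_rational_of_frobP1_eq_self y hy
  obtain ⟨w, hw, rfl⟩ := exists_rational_of_frobP1_eq_self z hz
  simp only [ne_eq, mk_eq_mk_iff_mul_eq_mul, ← map_mul, (ι).injective.eq_iff] at hxy hxz hyz
  rw [← sub_eq_zero] at hxy hxz hyz
  let a := w 0 * v 1 - w 1 * v 0
  let b := u 0 * w 1 - u 1 * w 0
  have hdet : (!![a * u 0, b * v 0; a * u 1, b * v 1] : Matrix (Fin 2) (Fin 2) K).det ≠ 0 := by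
    rw [Matrix.det_fin_two_of]
    have : a * u 0 * (b * v 1) - b * v 0 * (a * u 1) =
      -(v 0 * w 1 - v 1 * w 0) * (u 0 * w 1 - u 1 * w 0) * (u 0 * v 1 - u 1 * v 0) := by
      simp only [a, b]
      ring
    rw [this]
    exact mul_ne_zero (mul_ne_zero (neg_ne_zero.mpr hyz) hxz) hxy
  refine ⟨QuotientGroup.mk (Matrix.GeneralLinearGroup.mkOfDetNeZero _ hdet), ?_, ?_, ?_⟩ <;>
  · rw [pgl_smul_mk, mk_eq_mk_iff_mul_eq_mul]
    simp [Matrix.GeneralLinearGroup.mkOfDetNeZero, Matrix.mulVec, dotProduct, Fin.sum_univ_two,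
      a, b]
    ring

/-- An element of `PGL₂(K)` fixing `[1 : 0]`, `[0 : 1]` and `[1 : 1]` acts trivially. -/
theorem pgl_smul_eq_self (g : PGL2 K)
    (h₀ : g • mk Kbar ![(1 : Kbar), 0] (by simp) = mk Kbar ![(1 : Kbar), 0] (by simp))
    (h₁ : g • mk Kbar ![(0 : Kbar), 1] (by simp) = mk Kbar ![(0 : Kbar), 1] (by simp))
    (h₂ : g • mk Kbar ![(1 : Kbar), 1] (by simp) = mk Kbar ![(1 : Kbar), 1] (by simp))
    (x : Projectivization Kbar (Fin 2 → Kbar)) : g • x = x := by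
  induction g using QuotientGroup.induction_on with | H g => ?_
  induction x using Projectivization.ind with | h v hv => ?_
  rw [pgl_smul_mk, mk_eq_mk_iff_mul_eq_mul] at h₀ h₁ h₂ ⊢
  simp [Matrix.mulVec, dotProduct, Fin.sum_univ_two, -map_eq_zero,
    -FaithfulSMul.algebraMap_eq_zero_iff] at h₀ h₁ h₂ ⊢
  linear_combination v 0 * v 1 * h₂ + (v 1 ^ 2 - v 0 * v 1) * h₁ - (v 0 * v 1 - v 0 ^ 2) * h₀

/-- The normalised configuration with first point `[t : 1]` and last three points
`[1 : 0]`, `[0 : 1]`, `[1 : 1]`. -/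
noncomputable def standardTuple {L : Type*} [Field L] (q : ℕ) (t : L) :
    Fin 6 → Projectivization L (Fin 2 → L) :=
  ![mk L ![t, 1] (by simp), mk L ![t ^ q, 1] (by simp), mk L ![(t ^ q) ^ q, 1] (by simp),
    mk L ![1, 0] (by simp), mk L ![0, 1] (by simp), mk L ![1, 1] (by simp)]

theorem standardTuple_injective {L : Type*} [Field L] {q : ℕ} (hq : q ≠ 0) {t : L}
    (ht : t ^ q ^ 3 = t) (ht' : t ^ q ≠ t) : Function.Injective (standardTuple q t) := by
  have h3 : ((t ^ q) ^ q) ^ q = t := by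
    rw [← pow_mul, ← pow_mul, ← pow_three, ht]
  have h0 : t ≠ 0 := by rintro rfl; simp [hq] at ht'
  have h1 : t ≠ 1 := by rintro rfl; simp at ht'
  have h1' : t ^ q ≠ 1 := fun h => h1 (by rw [← h3, h]; simp)
  have h1'' : (t ^ q) ^ q ≠ 1 := fun h => h1 (by rw [← h3, h]; simp)
  have h02 : (t ^ q) ^ q ≠ t := fun h => ht' (by rw [h] at h3; exact h3)
  have h12 : (t ^ q) ^ q ≠ t ^ q := fun h => ht' (by rwa [h, h] at h3)
  intro i j h
  fin_cases i <;> fin_cases j <;>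
    first
    | rfl
    | simp [standardTuple, mk_eq_mk_iff_mul_eq_mul, *, ht'.symm, h02.symm, h12.symm, h1.symm,
        h1'.symm, h1''.symm, h0.symm, (pow_ne_zero q h0).symm,
        (pow_ne_zero q (pow_ne_zero q h0)).symm] at h

theorem standardTuple_eq_of_pgl_smul {q : ℕ} {s t : Kbar} (g : PGL2 K)
    (h : g • standardTuple q s = standardTuple q t) : s = t := by
  rw [← mk_affine_inj]
  exact (pgl_smul_eq_self g (congrFun h 3) (congrFun h 4) (congrFun h 5) _).symm.trans
    (congrFun h 0)

theorem exists_pgl_smul_standardTuple_eq [Fintype K]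
    {x : Fin 6 → Projectivization Kbar (Fin 2 → Kbar)} (hinj : Function.Injective x)
    (h0 : frobP1 (Fintype.card K) (x 0) = x 1) (h1 : frobP1 (Fintype.card K) (x 1) = x 2)
    (h2 : frobP1 (Fintype.card K) (x 2) = x 0) (h3 : frobP1 (Fintype.card K) (x 3) = x 3)
    (h4 : frobP1 (Fintype.card K) (x 4) = x 4) (h5 : frobP1 (Fintype.card K) (x 5) = x 5) :
    ∃ t : Kbar, t ^ Fintype.card K ^ 3 = t ∧ t ^ Fintype.card K ≠ t ∧
      ∃ g : PGL2 K, g • standardTuple (Fintype.card K) t = x := by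
  obtain ⟨g, g3, g4, g5⟩ := exists_pgl_smul_eq h3 h4 h5 (hinj.ne (by decide))
    (hinj.ne (by decide)) (hinj.ne (by decide))
  obtain h | ⟨t, ht⟩ := eq_mk_infinity_or_affine (g⁻¹ • x 0)
  · rw [inv_smul_eq_iff, g3] at h
    exact absurd (hinj h) (by decide)
  rw [inv_smul_eq_iff] at ht
  have g1 : x 1 = g • mk Kbar ![t ^ Fintype.card K, 1] (by simp) := by
    rw [← h0, ht, frobP1_smul, frobP1_affine]
  have g2 : x 2 = g • mk Kbar ![(t ^ Fintype.card K) ^ Fintype.card K, 1] (by simp) := by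
    rw [← h1, g1, frobP1_smul, frobP1_affine]
  rw [g2, ht, frobP1_smul, frobP1_affine, smul_left_cancel_iff, mk_affine_inj] at h2
  refine ⟨t, ?_, fun h => ?_, g, ?_⟩
  · rw [pow_three', pow_mul, pow_mul, h2]
  · have : x 1 = x 0 := by rw [g1, ht, smul_left_cancel_iff, mk_affine_inj, h]
    exact absurd (hinj this) (by decide)
  · ext1 i
    fin_cases i
    exacts [ht.symm, g1.symm, g2.symm, g3, g4, g5]

theorem card_frobenius_period_three [Fintype K] :
    (Nat.card {t : Kbar // t ^ Fintype.card K ^ 3 = t ∧ t ^ Fintype.card K ≠ t} : ℤ) =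
      (Fintype.card K : ℤ) ^ 3 - Fintype.card K := by
  have h1 := ncard_pow_card_pow_eq_self (K := K) one_ne_zero
  have h3 := ncard_pow_card_pow_eq_self (K := K) three_ne_zero
  rw [pow_one] at h1
  have hsub : {t : Kbar | t ^ Fintype.card K = t} ⊆ {t | t ^ Fintype.card K ^ 3 = t} := by
    intro t ht
    have ht : t ^ Fintype.card K = t := ht
    change t ^ Fintype.card K ^ 3 = t
    simp only [pow_three', pow_mul, ht]
  have h := Set.ncard_sdiff_add_ncard_of_subset hsub
    (Set.finite_of_ncard_ne_zero (by rw [h3]; exact pow_ne_zero _ Fintype.card_ne_zero))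
  rw [h1, h3] at h
  have hcard : Nat.card {t : Kbar // t ^ Fintype.card K ^ 3 = t ∧ t ^ Fintype.card K ≠ t} =
      ({t : Kbar | t ^ Fintype.card K ^ 3 = t} \ {t | t ^ Fintype.card K = t}).ncard :=
    Nat.card_coe_set_eq _
  rw [hcard, eq_sub_iff_add_eq]
  exact_mod_cast h

end Closure

/-- the number of `PGL₂(K)`-orbits of injective 6-tuples on `P¹(K̄)`
satisfying the stated Frobenius conditions. -/
theorem statement7 (q : ℕ) (hq : IsPrimePow q)
    (K : Type*) [Field K] [Fintype K] (hK : Fintype.card K = q) :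
    (Nat.card (Quotient (Setoid.comap
      (Subtype.val :
        {x : Fin 6 → Projectivization (AlgebraicClosure K) (Fin 2 → AlgebraicClosure K) //
          Function.Injective x ∧
          frobP1 q (x 0) = x 1 ∧
          frobP1 q (x 1) = x 2 ∧
          frobP1 q (x 2) = x 0 ∧
          frobP1 q (x 3) = x 3 ∧
          frobP1 q (x 4) = x 4 ∧
          frobP1 q (x 5) = x 5} →
        (Fin 6 → Projectivization (AlgebraicClosure K) (Fin 2 → AlgebraicClosure K)))
      (MulAction.orbitRel (PGL2 K)
        (Fin 6 → Projectivization (AlgebraicClosure K) (Fin 2 → AlgebraicClosure K))))) : ℤ)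
    = (q : ℤ) ^ 3 - (q : ℤ) := by
  subst hK
  rw [← card_frobenius_period_three]
  congr 1
  symm
  refine Nat.card_congr (Equiv.ofBijective (fun t => Quotient.mk _
    ⟨standardTuple (Fintype.card K) t.1,
      standardTuple_injective Fintype.card_ne_zero t.2.1 t.2.2, ?_⟩) ⟨?_, ?_⟩)
  · have hfixed {v : Fin 2 → AlgebraicClosure K} (hv : v ≠ 0)
        (h : (fun i => v i ^ Fintype.card K) = v) :
        frobP1 (Fintype.card K) (mk _ v hv) = mk _ v hv := by
      rw [frobP1_mk _ _ _ (by rwa [h])]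
      simp only [h]
    refine ⟨frobP1_affine _ _, frobP1_affine _ _, (frobP1_affine _ _).trans ?_,
      hfixed _ ?_, hfixed _ ?_, hfixed _ ?_⟩
    · rw [standardTuple, Matrix.cons_val_zero, mk_affine_inj, ← pow_mul, ← pow_mul,
        ← pow_three,
        t.2.1]
    all_goals
      ext i
      fin_cases i <;> simp
  · intro s t h
    obtain ⟨g, hg⟩ := Quotient.exact h
    exact Subtype.ext (standardTuple_eq_of_pgl_smul g hg).symm
  · intro y
    induction y using Quotient.inductionOn with | h x => ?_
    obtain ⟨x, hinj, h0, h1, h2, h3, h4, h5⟩ := x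
    obtain ⟨t, ht, ht', g, hg⟩ := exists_pgl_smul_standardTuple_eq hinj h0 h1 h2 h3 h4 h5
    refine ⟨⟨t, ht, ht'⟩, Quotient.sound ⟨g⁻¹, ?_⟩⟩
    exact inv_smul_eq_iff.mpr hg.symm
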